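/- arXiv:math/0106045 — 8 statements merged into one kernel-verified Lean document; each statement's English description precedes it below -/
import Mathlib

section
/- For every real number γ with 0 < γ ≤ 1 and every real number t ≥ 0, one has (1 + t^γ)^γ ≤ (1 + 0.13·(1 − γ))·(1 + t). -/
theorem aux_log (γ : ℝ) (h0 : 0 < γ) (h1 : γ ≤ 1) :
    (1 + γ) * Real.log γ ≤ -2 * (1 - γ) - (1 - γ) ^ 3 / 6 := by
  have hp : 0 < 1 + γ := by linarith
  obtain ⟨x, hx⟩ : ∃ x, x = (1 - γ) / (1 + γ) := ⟨_, rfl⟩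
  have hx0 : 0 ≤ x := by rw [hx]; exact div_nonneg (by linarith) hp.le
  have hx1 : x < 1 := by rw [hx, div_lt_one hp]; linarith
  have hs := Real.hasSum_log_sub_log_of_abs_lt_one (x := x) (by rw [abs_of_nonneg hx0]; exact hx1)
  have h2 := sum_le_hasSum (Finset.range 2) (fun i _ => by positivity) hs
  have e1 : 1 + x = 2 / (1 + γ) := by rw [hx]; field_simp; ring
  have e2 : 1 - x = 2 / (1 + γ) * γ := by rw [hx]; field_simp; ring
  rw [e1, e2, Real.log_mul (by positivity) (by positivity)] at h2
  simp [Finset.sum_range_succ] at h2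
  have hxm : x * (1 + γ) = 1 - γ := by rw [hx]; field_simp
  have hxg : (1 - γ) / 2 ≤ x := by
    rw [hx]; exact div_le_div_of_nonneg_left (by linarith) hp (by linarith)
  have h3 : ((1 - γ) / 2) ^ 2 ≤ x ^ 2 := pow_le_pow_left₀ (by linarith) hxg 2
  have h4 : (1 + γ) * (2 * x + 2 / 3 * x ^ 3) ≤ (1 + γ) * (- Real.log γ) :=
    mul_le_mul_of_nonneg_left (by norm_num at h2 ⊢; linarith) hp.le
  have h5 : (1 + γ) * (2 * x + 2 / 3 * x ^ 3) = 2 * (1 - γ) + 2 / 3 * ((1 - γ) * x ^ 2) := by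
    rw [← hxm]; ring
  have h6 := mul_le_mul_of_nonneg_left h3 (show 0 ≤ 1 - γ by linarith)
  nlinarith

theorem aux_const : -Real.log 0.13 ≤ 2.041 := by
  have h : (0.13 : ℝ) = (2 ^ 3)⁻¹ * 1.04 := by norm_num
  rw [h, Real.log_mul (by norm_num) (by norm_num), Real.log_inv, Real.log_pow]
  have h1 := Real.one_sub_inv_le_log_of_pos (show (0 : ℝ) < 1.04 by norm_num)
  have h2 := Real.log_two_lt_d9
  norm_num at h1 h2 ⊢
  linarith

theorem aux_main (γ : ℝ) (h0 : 0 < γ) (h1 : γ ≤ 1) :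
    γ ^ 2 * (γ / 0.13) ^ ((1 - γ) / γ) ≤ 1 + 0.13 * (1 - γ) := by
  have hK : 0 < 1 + 0.13 * (1 - γ) := by nlinarith
  have hq : 0 < γ / 0.13 := by positivity
  rw [← Real.log_le_log_iff (by positivity) hK, Real.log_mul (by positivity) (by positivity),
    Real.log_rpow hq, Real.log_pow, Real.log_div h0.ne' (by norm_num)]
  have hl := Real.one_sub_inv_le_log_of_pos hK
  have hl2 : 0.115 * (1 - γ) ≤ 1 - (1 + 0.13 * (1 - γ))⁻¹ := by
    have : 1 - (1 + 0.13 * (1 - γ))⁻¹ = 0.13 * (1 - γ) / (1 + 0.13 * (1 - γ)) := by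
      field_simp; ring
    rw [this, le_div_iff₀ hK]
    nlinarith [mul_nonneg (sub_nonneg.2 h1) h0.le]
  have ha := aux_log γ h0 h1
  have hc := aux_const
  have hc2 := mul_le_mul_of_nonneg_left hc (sub_nonneg.2 h1)
  have hr := mul_le_mul_of_nonneg_left (hl2.trans hl) h0.le
  have key : 0 ≤ (1 - γ) * (0.115 * γ - 0.041 + (1 - γ) ^ 2 / 6) :=
    mul_nonneg (by linarith) (by nlinarith [sq_nonneg (γ - 0.655)])
  have hfin : (1 + γ) * Real.log γ + (1 - γ) * (-Real.log 0.13)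
      ≤ γ * Real.log (1 + 0.13 * (1 - γ)) := by nlinarith
  refine le_of_mul_le_mul_left ?_ h0
  refine le_trans (le_of_eq ?_) hfin
  push_cast
  field_simp
  ring

theorem rpow_ineq (γ t : ℝ) (hγ0 : 0 < γ) (hγ1 : γ ≤ 1) (ht : 0 ≤ t) :
    (1 + t ^ γ) ^ γ ≤ (1 + 0.13 * (1 - γ)) * (1 + t) := by
  have htp : 0 ≤ t ^ γ := Real.rpow_nonneg ht γ
  have hb := rpow_one_add_le_one_add_mul_self (s := t ^ γ) (by linarith) hγ0.le hγ1
  have hm := aux_main γ hγ0 hγ1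
  have hq : 0 < γ / 0.13 := by positivity
  obtain ⟨a, ha⟩ : ∃ a, a = (γ / 0.13) ^ ((1 - γ) / γ) := ⟨_, rfl⟩
  have ha0 : 0 ≤ a := by rw [ha]; positivity
  have hg := Real.geom_mean_le_arith_mean2_weighted (w₁ := γ) (w₂ := 1 - γ) (p₁ := a * t)
    (p₂ := (γ / 0.13)⁻¹) hγ0.le (by linarith) (by positivity) (by positivity) (by ring)
  have he : a ^ γ = (γ / 0.13) ^ (1 - γ) := by
    rw [ha, ← Real.rpow_mul hq.le, div_mul_cancel₀ _ hγ0.ne']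
  have hne : (γ / 0.13) ^ (1 - γ) ≠ 0 := (Real.rpow_pos_of_pos hq _).ne'
  rw [Real.mul_rpow ha0 ht, he, Real.inv_rpow hq.le, mul_right_comm, mul_inv_cancel₀ hne,
    one_mul] at hg
  rw [← ha] at hm
  have h1 := mul_le_mul_of_nonneg_left hg hγ0.le
  have h2 : γ * (γ * (a * t) + (1 - γ) * (γ / 0.13)⁻¹) = γ ^ 2 * a * t + 0.13 * (1 - γ) := by
    field_simp
  have h3 := mul_le_mul_of_nonneg_right hm ht
  linarith
end

section
/- For every real number s > 0, one has log(1 + s) + s·log(s)/(1 + s) ≥ −0.1144. -/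
/-- The tangent-line bound for `x log x`. -/
theorem tangent_xlogx (x a : ℝ) (hx : 0 < x) (ha : 0 < a) :
    x * Real.log x ≥ x * Real.log a + x - a := by
  have h := Real.log_le_sub_one_of_pos (div_pos ha hx)
  rw [Real.log_div ha.ne' hx.ne'] at h
  have h2 := mul_le_mul_of_nonneg_left h hx.le
  have h3 : x * (a / x - 1) = a - x := by field_simp
  rw [h3] at h2
  linarith

theorem log_ineq (s : ℝ) (hs : 0 < s) :
    Real.log (1 + s) + s * Real.log s / (1 + s) ≥ -0.1144 := by
  have h1 : (0.10332 : ℝ) ≤ Real.log 1.10886 := by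
    rw [Real.le_log_iff_exp_le (by norm_num)]
    have h := Real.exp_bound' (x := 0.10332) (by norm_num) (by norm_num) (n := 6) (by norm_num)
    refine h.trans ?_
    norm_num [Finset.sum_range_succ, Nat.factorial]
  have h2 : (-2.1144 : ℝ) ≤ Real.log 1.10886 + Real.log 0.10886 := by
    rw [← Real.log_mul (by norm_num) (by norm_num), Real.le_log_iff_exp_le (by norm_num),
      Real.exp_neg]
    have h := Real.sum_le_exp_of_nonneg (x := 2.1144) (by norm_num) 16
    apply inv_le_of_inv_le₀ (by norm_num)
    refine le_trans ?_ h
    norm_num [Finset.sum_range_succ, Nat.factorial]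
  have t1 := tangent_xlogx (1 + s) 1.10886 (by linarith) (by norm_num)
  have t2 := tangent_xlogx s 0.10886 hs (by norm_num)
  have hp : 0 < 1 + s := by linarith
  have e : Real.log (1 + s) + s * Real.log s / (1 + s)
      = ((1 + s) * Real.log (1 + s) + s * Real.log s) / (1 + s) := by field_simp
  rw [e, ge_iff_le, le_div_iff₀ hp]
  have h3 := mul_le_mul_of_nonneg_left h2 hs.le
  nlinarith
end

section
/- Let n ≥ 2, let D ⊆ ℝⁿ be a set containing the origin, let M ≥ 1 and 0 < γ ≤ 1 be real numbers, and let g : D → ℝⁿ be a map with g(0) = 0 which is γ-biHölder with constant M, i.e. (|x − y|/M)^{1/γ} ≤ |g(x) − g(y)| ≤ M·|x − y|^γ for all x, y ∈ D. Then for all x, y ∈ D, q(g(x), g(y)) ≤ M^{1+2γ}·(1 + 0.13·(1 − γ))·q(x, y)^γ. -/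
/-- The spherical (chordal) metric on `ℝⁿ`. -/
noncomputable def sphericalDist {n : ℕ} (x y : EuclideanSpace ℝ (Fin n)) : ℝ :=
  ‖x - y‖ / (Real.sqrt (1 + ‖x‖ ^ 2) * Real.sqrt (1 + ‖y‖ ^ 2))

lemma aux_log_s2 : Real.log (100/13) ≤ 2.042 := by
  rw [Real.log_le_iff_le_exp (by norm_num)]
  have h1 := Real.exp_one_gt_d9
  have h2 := Real.add_one_le_exp (0.042:ℝ)
  have h3 : Real.exp 2.042 = Real.exp 1 * Real.exp 1 * Real.exp 0.042 := by
    rw [← Real.exp_add, ← Real.exp_add]; norm_num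
  have h4 : (2.718:ℝ) * 2.718 ≤ Real.exp 1 * Real.exp 1 := by
    apply mul_le_mul <;> linarith
  have h5 : (2.718:ℝ) * 2.718 * 1.042 ≤ Real.exp 1 * Real.exp 1 * Real.exp 0.042 := by
    apply mul_le_mul h4 (by linarith) (by norm_num) (by positivity)
  rw [h3]
  norm_num at h5 ⊢
  linarith

lemma aux_s (s : ℝ) (hs : 0 ≤ s) :
    Real.log (100/13) * s - (2 + s) * Real.log (1 + s) ≤ Real.log (1 + 0.13 * (s / (1 + s))) := by
  have hL := aux_log_s2
  have hLs : Real.log (100/13) * s ≤ 2.042 * s := mul_le_mul_of_nonneg_right hL hs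
  rcases le_total s 1.5 with h | h
  · have h1 := Real.le_log_one_add_of_nonneg hs
    have h2 : 2 * s ≤ (2 + s) * Real.log (1 + s) := by
      rw [div_le_iff₀ (by linarith)] at h1
      linarith
    have h3 := Real.one_sub_inv_le_log_of_pos (x := 1 + 0.13 * (s / (1 + s))) (by positivity)
    have h4 : 0.042 * s ≤ 1 - (1 + 0.13 * (s / (1 + s)))⁻¹ := by
      have : 1 - (1 + 0.13 * (s / (1 + s)))⁻¹ = 0.13 * s / (1 + 1.13 * s) := by
        have : 1 + 0.13 * (s / (1 + s)) = (1 + 1.13 * s) / (1 + s) := by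
          field_simp; ring
        rw [this]
        have h1s : (1 + 1.13 * s) ≠ 0 := by positivity
        rw [inv_div, eq_div_iff h1s, sub_mul, div_mul_cancel₀ _ h1s]
        ring
      rw [this, le_div_iff₀ (by positivity)]
      nlinarith
    linarith
  · have h0 : 0 ≤ Real.log (1 + 0.13 * (s / (1 + s))) := by
      apply Real.log_nonneg
      have : 0 ≤ s / (1 + s) := by positivity
      linarith
    obtain ⟨r, hr, hrs⟩ : ∃ r : ℝ, 1.5 ≤ r ∧ r ^ 2 = 1 + s :=
      ⟨Real.sqrt (1 + s), Real.le_sqrt_of_sq_le (by norm_num at h ⊢; linarith),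
        Real.sq_sqrt (by linarith)⟩
    have h1 := Real.le_log_one_add_of_nonneg (x := r - 1) (by linarith)
    have h2 : Real.log (1 + s) = 2 * Real.log r := by
      rw [← hrs, Real.log_pow]; norm_num
    rw [show 1 + (r - 1) = r by ring, div_le_iff₀ (by linarith)] at h1
    have h3 : 2.042 * (r + 1) ^ 2 ≤ 4 * (r ^ 2 + 1) := by nlinarith
    have hs' : s = r ^ 2 - 1 := by linarith
    have h4 : 2.042 * s * (r + 1) ≤ (2 + s) * (2 * Real.log r) * (r + 1) := by
      have h5 : (2 + s) * (2 * (2 * (r - 1))) ≤ (2 + s) * (2 * (Real.log r * (r - 1 + 2))) := by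
        apply mul_le_mul_of_nonneg_left _ (by linarith)
        linarith
      have h6 := mul_le_mul_of_nonneg_right h3 (show 0 ≤ r - 1 by linarith)
      rw [hs'] at h5 ⊢
      nlinarith
    have h7 := le_of_mul_le_mul_right h4 (by linarith)
    rw [h2]
    linarith

lemma aux_a (γ : ℝ) (h0 : 0 < γ) (h1 : γ ≤ 1) :
    0.13 * γ ≤ (1 + 0.13 * (1 - γ)) * (0.13 / γ) ^ (1 / γ) := by
  have hC : 0 < 1 + 0.13 * (1 - γ) := by linarith
  have ha : (0:ℝ) < 0.13 / γ := by positivity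
  have hs := aux_s (1 / γ - 1) (by rw [sub_nonneg, le_div_iff₀ h0]; linarith)
  rw [← Real.log_le_log_iff (by positivity) (by positivity),
    Real.log_mul hC.ne' (by positivity), Real.log_rpow ha,
    Real.log_mul (by norm_num) h0.ne', Real.log_div (by norm_num) h0.ne']
  have e1 : Real.log (100/13) = - Real.log 0.13 := by
    rw [← Real.log_inv]; norm_num
  have e2 : (1 / γ - 1) / (1 + (1 / γ - 1)) = 1 - γ := by
    field_simp; ring
  have e3 : Real.log (1 + (1 / γ - 1)) = - Real.log γ := by
    rw [← Real.log_inv]; congr 1; rw [one_div]; ring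
  rw [e2, e3, e1] at hs
  linarith

lemma aux_u (γ u : ℝ) (h0 : 0 < γ) (h1 : γ ≤ 1) (hu : 0 ≤ u) :
    (1 + u) ^ γ ≤ (1 + 0.13 * (1 - γ)) * (1 + u ^ (1 / γ)) := by
  have hb := rpow_one_add_le_one_add_mul_self (s := u) (by linarith) h0.le h1
  have hk := aux_a γ h0 h1
  have hapos : (0:ℝ) < (0.13 / γ) ^ (1 / γ) := by positivity
  have haγ : ((0.13 / γ) ^ (1 / γ)) ^ γ = 0.13 / γ := by
    rw [← Real.rpow_mul (by positivity), one_div_mul_cancel h0.ne', Real.rpow_one]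
  have hvγ : (u ^ (1 / γ)) ^ γ = u := by
    rw [← Real.rpow_mul hu, one_div_mul_cancel h0.ne', Real.rpow_one]
  have hv : 0 ≤ u ^ (1 / γ) := by positivity
  generalize (0.13 / γ) ^ (1 / γ) = a at *
  generalize u ^ (1 / γ) = v at *
  have hy := Real.geom_mean_le_arith_mean2_weighted (w₁ := 1 - γ) (w₂ := γ) (p₁ := a) (p₂ := v)
    (by linarith) h0.le hapos.le hv (by ring)
  rw [hvγ, Real.rpow_sub hapos, Real.rpow_one, haγ] at hy
  have e : a / (0.13 / γ) * u = a * (γ * u) / 0.13 := by field_simp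
  rw [e, div_le_iff₀ (by norm_num)] at hy
  have hkv := mul_le_mul_of_nonneg_right hk hv
  have : γ * u ≤ 0.13 * (1 - γ) + (1 + 0.13 * (1 - γ)) * v := by
    refine le_of_mul_le_mul_left ?_ hapos
    linarith
  linarith

lemma aux_X (γ M t w : ℝ) (h0 : 0 < γ) (h1 : γ ≤ 1) (hM : 1 ≤ M) (ht : 0 ≤ t)
    (hw : (t / M) ^ (1 / γ) ≤ w) :
    Real.sqrt (1 + t ^ 2) ^ γ ≤
      M ^ γ * Real.sqrt (1 + 0.13 * (1 - γ)) * Real.sqrt (1 + w ^ 2) := by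
  have hM0 : 0 < M := by linarith
  have hC : 0 ≤ 1 + 0.13 * (1 - γ) := by linarith
  have htM : 0 ≤ t / M := by positivity
  have hu := aux_u γ ((t / M) ^ 2) h0 h1 (by positivity)
  have e : ((t / M) ^ 2) ^ (1 / γ) = ((t / M) ^ (1 / γ)) ^ 2 := by
    rw [← Real.rpow_natCast, ← Real.rpow_natCast, ← Real.rpow_mul htM, ← Real.rpow_mul htM,
      mul_comm]
  have hw2 : ((t / M) ^ (1 / γ)) ^ 2 ≤ w ^ 2 := by gcongr
  rw [e] at hu
  have hX : 1 + t ^ 2 ≤ M ^ 2 * (1 + (t / M) ^ 2) := by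
    have : M ^ 2 * (1 + (t / M) ^ 2) = M ^ 2 + t ^ 2 := by field_simp
    rw [this]; nlinarith
  have hl : (Real.sqrt (1 + t ^ 2) ^ γ) ^ 2 = (1 + t ^ 2) ^ γ := by
    rw [← Real.rpow_natCast, ← Real.rpow_mul (by positivity), mul_comm, Real.rpow_mul (by positivity),
      Real.rpow_natCast, Real.sq_sqrt (by positivity)]
  have hm : (M ^ 2) ^ γ = (M ^ γ) ^ 2 := by
    rw [← Real.rpow_natCast, ← Real.rpow_natCast, ← Real.rpow_mul hM0.le, ← Real.rpow_mul hM0.le,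
      mul_comm]
  refine le_of_sq_le_sq ?_ (by positivity)
  rw [hl, mul_pow, mul_pow, Real.sq_sqrt hC, Real.sq_sqrt (by positivity)]
  calc (1 + t ^ 2) ^ γ ≤ (M ^ 2 * (1 + (t / M) ^ 2)) ^ γ := by gcongr
    _ = (M ^ γ) ^ 2 * (1 + (t / M) ^ 2) ^ γ := by
      rw [Real.mul_rpow (by positivity) (by positivity), hm]
    _ ≤ (M ^ γ) ^ 2 * ((1 + 0.13 * (1 - γ)) * (1 + w ^ 2)) := by
      gcongr
      exact hu.trans (by gcongr)
    _ = _ := by ring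

theorem holder_spherical {n : ℕ} (hn : 2 ≤ n) (D : Set (EuclideanSpace ℝ (Fin n)))
    (h0D : (0 : EuclideanSpace ℝ (Fin n)) ∈ D)
    (M γ : ℝ) (hM : 1 ≤ M) (hγ0 : 0 < γ) (hγ1 : γ ≤ 1)
    (g : EuclideanSpace ℝ (Fin n) → EuclideanSpace ℝ (Fin n))
    (hg0 : g 0 = 0)
    (hlow : ∀ x ∈ D, ∀ y ∈ D, (‖x - y‖ / M) ^ (1 / γ) ≤ ‖g x - g y‖)
    (hup : ∀ x ∈ D, ∀ y ∈ D, ‖g x - g y‖ ≤ M * ‖x - y‖ ^ γ) :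
    ∀ x ∈ D, ∀ y ∈ D,
      sphericalDist (g x) (g y) ≤
        M ^ (1 + 2 * γ) * (1 + 0.13 * (1 - γ)) * sphericalDist x y ^ γ := by
  intro x hx y hy
  have hM0 : 0 < M := by linarith
  have hC : 0 ≤ 1 + 0.13 * (1 - γ) := by linarith
  have hlx := hlow x hx 0 h0D
  have hly := hlow y hy 0 h0D
  have hd := hup x hx y hy
  rw [hg0, sub_zero, sub_zero] at hlx hly
  have hX := aux_X γ M ‖x‖ ‖g x‖ hγ0 hγ1 hM (norm_nonneg _) hlx
  have hY := aux_X γ M ‖y‖ ‖g y‖ hγ0 hγ1 hM (norm_nonneg _) hly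
  unfold sphericalDist
  rw [Real.div_rpow (by positivity) (by positivity),
    Real.mul_rpow (by positivity) (by positivity), mul_div_assoc',
    div_le_div_iff₀ (by positivity) (by positivity)]
  have hXY := mul_le_mul hX hY (by positivity) (by positivity)
  have hpow : M ^ (1 + 2 * γ) = M * (M ^ γ * M ^ γ) := by
    rw [Real.rpow_add hM0, Real.rpow_one, two_mul, Real.rpow_add hM0]
  have hCC := Real.mul_self_sqrt hC
  refine (mul_le_mul hd hXY (by positivity) (by positivity)).trans (le_of_eq ?_)
  rw [hpow]
  nth_rewrite 3 [← hCC]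
  ring
end

section
/- For all real numbers α, β with 0 ≤ α ≤ β ≤ π, one has √(2 − 2·cos α) + √(2 − 2·cos(β − α)) ≤ 2·√(1 − cos β). -/
theorem chord_ineq (α β : ℝ) (h0 : 0 ≤ α) (hαβ : α ≤ β) (hβ : β ≤ Real.pi) :
    Real.sqrt (2 - 2 * Real.cos α) + Real.sqrt (2 - 2 * Real.cos (β - α)) ≤
      2 * Real.sqrt (1 - Real.cos β) := by
  obtain ⟨x, hx⟩ : ∃ x, x = α / 2 := ⟨_, rfl⟩
  obtain ⟨y, hy⟩ : ∃ y, y = (β - α) / 2 := ⟨_, rfl⟩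
  have e1 : Real.cos α = 1 - 2 * Real.sin x ^ 2 := by
    rw [show α = 2 * x by linarith, Real.cos_two_mul, Real.cos_sq']; ring
  have e2 : Real.cos (β - α) = 1 - 2 * Real.sin y ^ 2 := by
    rw [show β - α = 2 * y by linarith, Real.cos_two_mul, Real.cos_sq']; ring
  have e3 : Real.cos β = 1 - 2 * Real.sin (x + y) ^ 2 := by
    rw [show β = 2 * (x + y) by linarith, Real.cos_two_mul, Real.cos_sq']; ring
  have hs : 0 ≤ Real.sin x :=
    Real.sin_nonneg_of_nonneg_of_le_pi (by linarith) (by linarith)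
  have ht : 0 ≤ Real.sin y :=
    Real.sin_nonneg_of_nonneg_of_le_pi (by linarith) (by linarith)
  have hc : 0 ≤ Real.cos (x + y) :=
    Real.cos_nonneg_of_neg_pi_div_two_le_of_le (by linarith) (by linarith)
  have key : Real.sin (x + y) ^ 2 =
      Real.sin x ^ 2 + Real.sin y ^ 2 + 2 * (Real.sin x * Real.sin y * Real.cos (x + y)) := by
    rw [Real.sin_add, Real.cos_add]
    linear_combination Real.sin x ^ 2 * Real.sin_sq_add_cos_sq y
      + Real.sin y ^ 2 * Real.sin_sq_add_cos_sq x
  have hp := mul_nonneg (mul_nonneg hs ht) hc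
  rw [e1, e2, e3, show 2 - 2 * (1 - 2 * Real.sin x ^ 2) = (2 * Real.sin x) ^ 2 by ring,
    show 2 - 2 * (1 - 2 * Real.sin y ^ 2) = (2 * Real.sin y) ^ 2 by ring,
    Real.sqrt_sq (by linarith), Real.sqrt_sq (by linarith)]
  have : Real.sin x + Real.sin y ≤ Real.sqrt (1 - (1 - 2 * Real.sin (x + y) ^ 2)) := by
    apply Real.le_sqrt_of_sq_le
    nlinarith [sq_nonneg (Real.sin x - Real.sin y)]
  linarith
end

section
/- Let n ≥ 2 and let x, y ∈ ℝⁿ satisfy |x| < 1 < |y|. Then there exists a point w on the line through x and y with |w| = 1 such that q(x, w) + q(w, y) ≤ √2 · q(x, y). -/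
lemma good_point {n : ℕ} (x y : EuclideanSpace ℝ (Fin n)) (t : ℝ)
    (hw : ‖x + t • (y - x)‖ = 1) (hP : 0 ≤ t * (1 - t) * (1 + inner ℝ x y)) :
    sphericalDist x (x + t • (y - x)) + sphericalDist (x + t • (y - x)) y
      ≤ Real.sqrt 2 * sphericalDist x y := by
  have h1 : ‖x - (x + t • (y - x))‖ = |t| * ‖x - y‖ := by
    rw [show x - (x + t • (y - x)) = t • (x - y) by module, norm_smul, Real.norm_eq_abs]
  have h2 : ‖x + t • (y - x) - y‖ = |1 - t| * ‖x - y‖ := by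
    rw [show x + t • (y - x) - y = (1 - t) • (x - y) by module, norm_smul, Real.norm_eq_abs]
  have h3 : (1 - t) ^ 2 * ‖x‖ ^ 2 + t ^ 2 * ‖y‖ ^ 2 + 2 * (t * (1 - t)) * inner ℝ x y = 1 := by
    have h : ‖(1 - t) • x + t • y‖ ^ 2 = 1 := by
      rw [show (1 - t) • x + t • y = x + t • (y - x) by module, hw]; norm_num
    rw [norm_add_sq_real, norm_smul, norm_smul, inner_smul_left, inner_smul_right, mul_pow,
      mul_pow, Real.norm_eq_abs, Real.norm_eq_abs, sq_abs, sq_abs] at h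
    simp only [conj_trivial] at h
    linarith
  unfold sphericalDist
  rw [h1, h2, hw]
  have hA0 : 0 < Real.sqrt (1 + ‖x‖ ^ 2) := by positivity
  have hB0 : 0 < Real.sqrt (1 + ‖y‖ ^ 2) := by positivity
  have hA : Real.sqrt (1 + ‖x‖ ^ 2) ^ 2 = 1 + ‖x‖ ^ 2 := Real.sq_sqrt (by positivity)
  have hB : Real.sqrt (1 + ‖y‖ ^ 2) ^ 2 = 1 + ‖y‖ ^ 2 := Real.sq_sqrt (by positivity)
  generalize Real.sqrt (1 + ‖x‖ ^ 2) = A at *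
  generalize Real.sqrt (1 + ‖y‖ ^ 2) = B at *
  rw [show (1 : ℝ) + 1 ^ 2 = 2 by norm_num]
  have hs0 : 0 < Real.sqrt 2 := by positivity
  have hs : Real.sqrt 2 ^ 2 = 2 := Real.sq_sqrt (by norm_num)
  generalize Real.sqrt 2 = s at *
  have key : |t| * B + |1 - t| * A ≤ 2 := by
    have e1 := sq_abs t
    have e2 := sq_abs (1 - t)
    have e : (|t| * B) ^ 2 + (|1 - t| * A) ^ 2 ≤ 2 := by
      rw [mul_pow, mul_pow, e1, e2, hA, hB]; nlinarith
    refine abs_le_of_sq_le_sq' ?_ (by norm_num) |>.2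
    nlinarith [sq_nonneg (|t| * B - |1 - t| * A)]
  have e1 : |t| * ‖x - y‖ / (A * s) + |1 - t| * ‖x - y‖ / (s * B)
      = ‖x - y‖ / (s * A * B) * (|t| * B + |1 - t| * A) := by
    field_simp
  have e2 : s * (‖x - y‖ / (A * B)) = ‖x - y‖ / (s * A * B) * 2 := by
    rw [← hs]; field_simp
  rw [e1, e2]
  gcongr

theorem exists_sphere_point {n : ℕ} (hn : 2 ≤ n) (x y : EuclideanSpace ℝ (Fin n))
    (hx : ‖x‖ < 1) (hy : 1 < ‖y‖) :
    ∃ w : EuclideanSpace ℝ (Fin n), (∃ t : ℝ, w = x + t • (y - x)) ∧ ‖w‖ = 1 ∧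
      sphericalDist x w + sphericalDist w y ≤ Real.sqrt 2 * sphericalDist x y := by
  have hc : Continuous (fun t : ℝ => ‖x + t • (y - x)‖) := by fun_prop
  suffices h : ∃ t : ℝ, ‖x + t • (y - x)‖ = 1 ∧ 0 ≤ t * (1 - t) * (1 + inner ℝ x y) by
    obtain ⟨t, h1, h2⟩ := h
    exact ⟨_, ⟨t, rfl⟩, h1, good_point x y t h1 h2⟩
  rcases le_total 0 (1 + inner ℝ x y) with hP | hP
  · obtain ⟨t, ht, h⟩ := intermediate_value_Icc (zero_le_one' ℝ) hc.continuousOn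
      (show (1 : ℝ) ∈ _ from ⟨by simpa using hx.le, by simpa using hy.le⟩)
    exact ⟨t, h, mul_nonneg (mul_nonneg ht.1 (by linarith [ht.2])) hP⟩
  · have hd : 0 < ‖y - x‖ := by linarith [norm_sub_norm_le y x]
    have hM : -(2 / ‖y - x‖) ≤ 0 := by
      have : 0 ≤ 2 / ‖y - x‖ := by positivity
      linarith
    have hf : 1 ≤ ‖x + (-(2 / ‖y - x‖)) • (y - x)‖ := by
      have h1 := norm_sub_norm_le ((2 / ‖y - x‖) • (y - x)) x
      rw [norm_smul, Real.norm_of_nonneg (by positivity), div_mul_cancel₀ _ hd.ne',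
        norm_sub_rev] at h1
      rw [neg_smul, ← sub_eq_add_neg]
      linarith
    obtain ⟨t, ht, h⟩ := intermediate_value_Icc' hM hc.continuousOn
      (show (1 : ℝ) ∈ _ from ⟨by simpa using hx.le, hf⟩)
    refine ⟨t, h, mul_nonneg_of_nonpos_of_nonpos ?_ hP⟩
    exact mul_nonpos_of_nonpos_of_nonneg ht.2 (by linarith [ht.2])
end

section
/- Let n ≥ 2, let M ≥ 1 and 0 < α ≤ 1 be real numbers, and let f : ℝⁿ → ℝⁿ be a map such that q(f(x), f(y)) ≤ M·q(x, y)^α holds whenever |x| ≤ 1 and |y| ≤ 1, and also whenever |x| ≥ 1 and |y| ≥ 1. Then q(f(x), f(y)) ≤ 2^{1 − α/2}·M·q(x, y)^α for all x, y ∈ ℝⁿ. -/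
theorem unit_norm {E : Type*} [NormedAddCommGroup E] [NormedSpace ℝ E] {p : E} (h : p ≠ 0) :
    ‖‖p‖⁻¹ • p‖ = 1 := by
  rw [norm_smul, norm_inv, norm_norm, inv_mul_cancel₀ (norm_ne_zero_iff.2 h)]

theorem sd_nonneg {n : ℕ} (x y : EuclideanSpace ℝ (Fin n)) : 0 ≤ sphericalDist x y := by
  unfold sphericalDist; positivity

theorem sd_comm {n : ℕ} (x y : EuclideanSpace ℝ (Fin n)) :
    sphericalDist x y = sphericalDist y x := by
  unfold sphericalDist; rw [norm_sub_rev, mul_comm]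

theorem sd_triangle {n : ℕ} (x y z : EuclideanSpace ℝ (Fin n)) :
    sphericalDist x z ≤ sphericalDist x y + sphericalDist y z := by
  let L : EuclideanSpace ℝ (Fin n) → WithLp 2 (EuclideanSpace ℝ (Fin n) × ℝ) :=
    fun x => WithLp.toLp 2 (x, 0)
  let N : WithLp 2 (EuclideanSpace ℝ (Fin n) × ℝ) := WithLp.toLp 2 (0, 1)
  have hLL : ∀ x y, dist (L x) (L y) = ‖x - y‖ := by
    intro x y
    rw [WithLp.prod_dist_eq_of_L2]
    simp [L, dist_eq_norm]
  have hLN : ∀ x, dist (L x) N = Real.sqrt (1 + ‖x‖ ^ 2) := by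
    intro x
    rw [WithLp.prod_dist_eq_of_L2]
    simp [L, N, add_comm]
  have h := EuclideanGeometry.mul_dist_le_mul_dist_add_mul_dist (L x) (L y) (L z) N
  simp only [hLL, hLN] at h
  unfold sphericalDist
  have hx : 0 < Real.sqrt (1 + ‖x‖ ^ 2) := by positivity
  have hy : 0 < Real.sqrt (1 + ‖y‖ ^ 2) := by positivity
  have hz : 0 < Real.sqrt (1 + ‖z‖ ^ 2) := by positivity
  rw [div_add_div _ _ (by positivity) (by positivity), div_le_div_iff₀ (by positivity) (by positivity)]
  have := mul_le_mul_of_nonneg_right h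
    (by positivity : 0 ≤ Real.sqrt (1 + ‖x‖ ^ 2) * Real.sqrt (1 + ‖y‖ ^ 2) * Real.sqrt (1 + ‖z‖ ^ 2))
  nlinarith [this]

theorem sd_sq {n : ℕ} (x y : EuclideanSpace ℝ (Fin n)) :
    sphericalDist x y ^ 2 =
      (‖x‖ ^ 2 - 2 * inner ℝ x y + ‖y‖ ^ 2) / ((1 + ‖x‖ ^ 2) * (1 + ‖y‖ ^ 2)) := by
  unfold sphericalDist
  rw [div_pow, mul_pow, Real.sq_sqrt (by positivity), Real.sq_sqrt (by positivity),
    norm_sub_sq_real]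

/-- abstract sphere lemma -/
theorem sphere_pt {E : Type*} [NormedAddCommGroup E] [InnerProductSpace ℝ E] (u v e : E)
    (he : ‖e‖ = 1) (a b : ℝ) (ha : 0 < a) (hb : 0 < b)
    (hu : ‖u‖ ^ 2 + a ^ 2 = 1) (hv : ‖v‖ ^ 2 + b ^ 2 = 1) :
    ∃ w : E, ‖w‖ = 1 ∧ 1 - a * b + inner ℝ u v ≤ inner ℝ w (u + v) := by
  have h1 : ‖u + v‖ ^ 2 = ‖u‖ ^ 2 + 2 * inner ℝ u v + ‖v‖ ^ 2 := norm_add_sq_real u v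
  have h2 : ‖u - v‖ ^ 2 = ‖u‖ ^ 2 - 2 * inner ℝ u v + ‖v‖ ^ 2 := norm_sub_sq_real u v
  have hp : ‖b • u + a • v‖ ^ 2 = b ^ 2 * ‖u‖ ^ 2 + 2 * (a * b * inner ℝ u v) + a ^ 2 * ‖v‖ ^ 2 := by
    rw [norm_add_sq_real, norm_smul, norm_smul, inner_smul_left, inner_smul_right, mul_pow, mul_pow]
    simp
    ring
  have hip : inner ℝ (b • u + a • v) (u + v) = (a + b) * (1 - a * b + inner ℝ u v) := by
    simp only [inner_add_left, inner_add_right, inner_smul_left, real_inner_self_eq_norm_sq,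
      real_inner_comm u v]
    simp
    linear_combination b * hu + a * hv
  have hnn : 0 ≤ 1 - a * b + inner ℝ u v := by nlinarith [sq_nonneg (a - b), sq_nonneg ‖u + v‖]
  have hle1 : inner ℝ u v - a * b ≤ 1 := by nlinarith [sq_nonneg (a + b), sq_nonneg ‖u - v‖]
  have hple : ‖b • u + a • v‖ ≤ a + b := by
    apply le_of_sq_le_sq _ (by positivity)
    nlinarith [mul_nonneg (mul_pos ha hb).le (sub_nonneg.2 hle1)]
  rcases eq_or_ne (b • u + a • v) 0 with h0 | h0
  · rw [h0, inner_zero_left] at hip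
    have hz : 1 - a * b + inner ℝ u v = 0 := by
      rcases mul_eq_zero.1 hip.symm with h | h
      · linarith
      · exact h
    have : ‖u + v‖ ^ 2 ≤ 0 := by nlinarith [sq_nonneg (a - b)]
    have huv : u + v = 0 := by
      have : ‖u + v‖ = 0 := by nlinarith [sq_nonneg ‖u + v‖, norm_nonneg (u + v)]
      exact norm_eq_zero.1 this
    exact ⟨e, he, by rw [huv, inner_zero_right, hz]⟩
  · have hpos : 0 < ‖b • u + a • v‖ := norm_pos_iff.2 h0
    refine ⟨‖b • u + a • v‖⁻¹ • (b • u + a • v), unit_norm h0, ?_⟩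
    rw [real_inner_smul_left, hip, inv_mul_eq_div, le_div_iff₀ hpos]
    nlinarith [mul_le_mul_of_nonneg_right hple hnn]

theorem sd_mid {n : ℕ} (x y : EuclideanSpace ℝ (Fin n)) (hx : ‖x‖ < 1) (hy : 1 < ‖y‖) :
    ∃ w : EuclideanSpace ℝ (Fin n), ‖w‖ = 1 ∧
      sphericalDist x w ^ 2 + sphericalDist w y ^ 2 ≤ sphericalDist x y ^ 2 := by
  have hA : 0 < 1 + ‖x‖ ^ 2 := by positivity
  have hB : 0 < 1 + ‖y‖ ^ 2 := by positivity
  have hy0 : y ≠ 0 := norm_pos_iff.1 (by linarith)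
  obtain ⟨w, hw, h⟩ := sphere_pt ((2 / (1 + ‖x‖ ^ 2)) • x) ((2 / (1 + ‖y‖ ^ 2)) • y)
    (‖y‖⁻¹ • y) (unit_norm hy0) ((1 - ‖x‖ ^ 2) / (1 + ‖x‖ ^ 2))
    ((‖y‖ ^ 2 - 1) / (1 + ‖y‖ ^ 2))
    (div_pos (by nlinarith [norm_nonneg x]) hA) (div_pos (by nlinarith) hB)
    (by rw [norm_smul, Real.norm_of_nonneg (by positivity)]; field_simp; ring)
    (by rw [norm_smul, Real.norm_of_nonneg (by positivity)]; field_simp; ring)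
  refine ⟨w, hw, ?_⟩
  rw [sd_sq, sd_sq, sd_sq, hw, ← sub_nonneg]
  rw [inner_add_right, real_inner_smul_left, real_inner_smul_right, real_inner_smul_right,
    real_inner_smul_right, real_inner_comm x w, ← sub_nonneg] at h
  have h' := mul_nonneg h (by norm_num : (0:ℝ) ≤ 1 / 2)
  refine h'.trans_eq ?_
  field_simp
  ring

theorem holder_mixed {n : ℕ} (M α : ℝ) (hM : 1 ≤ M) (hα0 : 0 < α) (hα1 : α ≤ 1)
    (f : EuclideanSpace ℝ (Fin n) → EuclideanSpace ℝ (Fin n))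
    (hin : ∀ x y, ‖x‖ ≤ 1 → ‖y‖ ≤ 1 →
      sphericalDist (f x) (f y) ≤ M * sphericalDist x y ^ α)
    (hout : ∀ x y, 1 ≤ ‖x‖ → 1 ≤ ‖y‖ →
      sphericalDist (f x) (f y) ≤ M * sphericalDist x y ^ α)
    (x y : EuclideanSpace ℝ (Fin n)) (hx : ‖x‖ < 1) (hy : 1 < ‖y‖) :
    sphericalDist (f x) (f y) ≤ 2 ^ (1 - α / 2) * M * sphericalDist x y ^ α := by
  obtain ⟨w, hw, h⟩ := sd_mid x y hx hy
  have e : ∀ t : ℝ, 0 ≤ t → (t ^ 2) ^ (α / 2) = t ^ α := by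
    intro t ht
    rw [← Real.rpow_natCast, ← Real.rpow_mul ht]
    congr 1
    push_cast
    ring
  have hp := sd_nonneg x w
  have hr := sd_nonneg w y
  have hc := (Real.concaveOn_rpow (by linarith : 0 ≤ α / 2) (by linarith : α / 2 ≤ 1)).2
    (Set.mem_Ici.2 (sq_nonneg (sphericalDist x w))) (Set.mem_Ici.2 (sq_nonneg (sphericalDist w y)))
    (by norm_num : (0:ℝ) ≤ 1 / 2) (by norm_num : (0:ℝ) ≤ 1 / 2) (by norm_num)
  simp only [smul_eq_mul, ← mul_add] at hc
  rw [e _ hp, e _ hr, Real.mul_rpow (by norm_num) (by positivity)] at hc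
  have hm : (sphericalDist x w ^ 2 + sphericalDist w y ^ 2) ^ (α / 2) ≤ sphericalDist x y ^ α := by
    rw [← e _ (sd_nonneg x y)]
    exact Real.rpow_le_rpow (by positivity) h (by linarith)
  have h2 : (2:ℝ) ^ (1 - α / 2) = 2 * (1 / 2 : ℝ) ^ (α / 2) := by
    rw [Real.rpow_sub (by norm_num), Real.rpow_one, one_div, Real.inv_rpow (by norm_num)]
    rfl
  have hk : (0:ℝ) ≤ (1 / 2 : ℝ) ^ (α / 2) := by positivity
  have hsum : sphericalDist x w ^ α + sphericalDist w y ^ α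
      ≤ 2 ^ (1 - α / 2) * sphericalDist x y ^ α := by
    rw [h2]
    nlinarith [mul_le_mul_of_nonneg_left hm hk]
  calc sphericalDist (f x) (f y)
      ≤ sphericalDist (f x) (f w) + sphericalDist (f w) (f y) := sd_triangle _ _ _
    _ ≤ M * sphericalDist x w ^ α + M * sphericalDist w y ^ α :=
        add_le_add (hin x w hx.le hw.le) (hout w y hw.ge hy.le)
    _ = M * (sphericalDist x w ^ α + sphericalDist w y ^ α) := by ring
    _ ≤ M * (2 ^ (1 - α / 2) * sphericalDist x y ^ α) :=
        mul_le_mul_of_nonneg_left hsum (by linarith)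
    _ = _ := by ring

theorem holder_patch {n : ℕ} (hn : 2 ≤ n) (M α : ℝ) (hM : 1 ≤ M) (hα0 : 0 < α) (hα1 : α ≤ 1)
    (f : EuclideanSpace ℝ (Fin n) → EuclideanSpace ℝ (Fin n))
    (hin : ∀ x y, ‖x‖ ≤ 1 → ‖y‖ ≤ 1 →
      sphericalDist (f x) (f y) ≤ M * sphericalDist x y ^ α)
    (hout : ∀ x y, 1 ≤ ‖x‖ → 1 ≤ ‖y‖ →
      sphericalDist (f x) (f y) ≤ M * sphericalDist x y ^ α) :
    ∀ x y, sphericalDist (f x) (f y) ≤ 2 ^ (1 - α / 2) * M * sphericalDist x y ^ α := by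
  intro x y
  have h1 : (1:ℝ) ≤ 2 ^ (1 - α / 2) := Real.one_le_rpow (by norm_num) (by linarith)
  have hq : 0 ≤ M * sphericalDist x y ^ α :=
    mul_nonneg (by linarith) (Real.rpow_nonneg (sd_nonneg x y) α)
  have key : sphericalDist (f x) (f y) ≤ M * sphericalDist x y ^ α →
      sphericalDist (f x) (f y) ≤ 2 ^ (1 - α / 2) * M * sphericalDist x y ^ α := by
    intro h
    nlinarith [mul_le_mul_of_nonneg_right h1 hq]
  rcases lt_or_ge ‖x‖ 1 with hx | hx
  · rcases le_or_gt ‖y‖ 1 with hy | hy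
    · exact key (hin x y hx.le hy)
    · exact holder_mixed M α hM hα0 hα1 f hin hout x y hx hy
  · rcases lt_or_ge ‖y‖ 1 with hy | hy
    · rcases hx.eq_or_lt with hx' | hx'
      · exact key (hin x y hx'.ge hy.le)
      · rw [sd_comm (f x), sd_comm x]
        exact holder_mixed M α hM hα0 hα1 f hin hout y x hy hx'
    · exact key (hout x y hx hy)
end

section
/- Let β be a real number with 1 < β ≤ 2, set α = 1/β and R = √((1 + 32^{1−β})/(1 − 32^{1−β})). Then R > 1 and R^{β − α} ≤ exp(0.73·√(β − 1)). -/
theorem R_pow_estimate (β : ℝ) (hβ1 : 1 < β) (hβ2 : β ≤ 2) :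
    let α : ℝ := 1 / β
    let R : ℝ := Real.sqrt ((1 + (32 : ℝ) ^ (1 - β)) / (1 - (32 : ℝ) ^ (1 - β)))
    1 < R ∧ R ^ (β - α) ≤ Real.exp (0.73 * Real.sqrt (β - 1)) := by
  intro α R
  have hq0 : 0 < (32 : ℝ) ^ (1 - β) := by positivity
  have hq1 : (32 : ℝ) ^ (1 - β) < 1 :=
    Real.rpow_lt_one_of_one_lt_of_neg (by norm_num) (by linarith)
  have ht : 0 < β - 1 := by linarith
  have hL : (3 : ℝ) ≤ Real.log 32 := by
    have h : Real.log 32 = 5 * Real.log 2 := by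
      rw [show (32 : ℝ) = 2 ^ 5 by norm_num, Real.log_pow]; norm_num
    have := Real.log_two_gt_d9
    rw [h]; linarith
  have hqb : (32 : ℝ) ^ (1 - β) * (1 + 3 * (β - 1)) ≤ 1 := by
    have h1 : (32 : ℝ) ^ (1 - β) * (32 : ℝ) ^ (β - 1) = 1 := by
      rw [← Real.rpow_add (by norm_num)]; simp
    have h2 : 1 + 3 * (β - 1) ≤ (32 : ℝ) ^ (β - 1) := by
      rw [Real.rpow_def_of_pos (by norm_num)]
      have := Real.add_one_le_exp (Real.log 32 * (β - 1))
      nlinarith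
    calc _ ≤ (32 : ℝ) ^ (1 - β) * (32 : ℝ) ^ (β - 1) := by gcongr
      _ = 1 := h1
  have hR1 : 1 < R := by
    apply Real.lt_sqrt_of_sq_lt
    rw [lt_div_iff₀ (by linarith)]
    linarith
  refine ⟨hR1, ?_⟩
  obtain ⟨s, hs0, hs⟩ : ∃ s : ℝ, 0 < s ∧ Real.sqrt (β - 1) = s :=
    ⟨_, Real.sqrt_pos.mpr ht, rfl⟩
  have hss : β - 1 = s ^ 2 := by rw [← hs, Real.sq_sqrt ht.le]
  have hA : (1 + (32 : ℝ) ^ (1 - β)) / (1 - (32 : ℝ) ^ (1 - β)) ≤ Real.exp (0.73 / s) := by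
    have h1 : (1 + (32 : ℝ) ^ (1 - β)) / (1 - (32 : ℝ) ^ (1 - β)) ≤ 1 + 2 / 3 * (1 / s) ^ 2 := by
      have : 1 + 2 / 3 * (1 / s) ^ 2 = (3 * s ^ 2 + 2) / (3 * s ^ 2) := by
        field_simp
      rw [this, div_le_div_iff₀ (by linarith) (by positivity)]
      rw [hss] at hqb
      nlinarith
    have hu : 0 < 1 / s := by positivity
    have h2 := Real.sum_le_exp_of_nonneg (x := 0.73 / s) (by positivity) 4
    simp only [Finset.sum_range_succ, Finset.sum_range_zero, Nat.factorial] at h2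
    rw [show (0.73 : ℝ) / s = 0.73 * (1 / s) by ring] at h2 ⊢
    generalize 1 / s = u at *
    refine h1.trans (le_trans ?_ h2)
    norm_num
    have h3 : 0 ≤ u * (0.73 + 0.0648 * u ^ 2 - 0.4003 * u) := by
      apply mul_nonneg hu.le
      nlinarith [sq_nonneg (u - 3.08)]
    have h4 : 0 ≤ u ^ 3 := by positivity
    nlinarith [sq_nonneg u]
  have hRe : R ≤ Real.exp (0.73 / s / 2) := by
    apply Real.sqrt_le_iff.mpr
    refine ⟨(Real.exp_pos _).le, ?_⟩
    rw [← Real.exp_nat_mul]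
    convert hA using 2
    push_cast; ring
  have hexp : β - α ≤ 2 * (β - 1) := by
    have : 1 / β * β = 1 := by field_simp
    have h : 2 - β ≤ 1 / β := by
      rw [le_div_iff₀ (by linarith)]; nlinarith [sq_nonneg (β - 1)]
    show β - 1 / β ≤ _
    linarith
  calc R ^ (β - α) ≤ R ^ (2 * (β - 1)) := Real.rpow_le_rpow_of_exponent_le hR1.le hexp
    _ ≤ (Real.exp (0.73 / s / 2)) ^ (2 * (β - 1)) :=
      Real.rpow_le_rpow (by linarith) hRe (by linarith)
    _ = Real.exp (0.73 * Real.sqrt (β - 1)) := by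
      rw [← Real.exp_mul, hs, hss]
      congr 1
      field_simp
end

section
/- Let n ≥ 2, let 0 < α ≤ 1, β = 1/α, let M ≥ 1, A ≥ 1, B ≥ 1 and R ≥ 1 be real numbers, and let f : ℝⁿ → ℝⁿ be a map with f(0) = 0 such that: (i) |f(x) − f(y)| ≤ M·|x − y|^α for all x, y with |x| ≤ R and |y| ≤ R; (ii) |x| ≤ A·|f(x)|^β for all x with |x| ≤ R and |f(x)| ≥ 1; (iii) |x| ≤ B·|f(x)|^α for all x with |x| ≤ R and |f(x)| ≤ 1. Then for all x, y with |x| ≤ R and |y| ≤ R, q(f(x), f(y)) ≤ M·max{A^{2α}, B^{2α}·(1 + 0.13·(1 − α))}·q(x, y)^α. -/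
lemma hs_log (α : ℝ) (h0 : 0 < α) (h1 : α ≤ 1) :
    Real.log α ≤ (1 - α) * Real.log 0.13 +
      α * (Real.log (1 + 0.13 * (1 - α)) - Real.log α) := by
  have hk : -2.041 ≤ Real.log 0.13 := by
    have e : (0.13 : ℝ) = 1.04 / 2 ^ 3 := by norm_num
    rw [e, Real.log_div (by norm_num) (by norm_num), Real.log_pow]
    have := Real.log_two_lt_d9
    have h := Real.one_sub_inv_le_log_of_pos (show (0 : ℝ) < 1.04 by norm_num)
    norm_num at h ⊢
    linarith
  have hl : 0.115 * (1 - α) ≤ Real.log (1 + 0.13 * (1 - α)) := by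
    have hp : 0 < 1 + 0.13 * (1 - α) := by linarith
    refine le_trans ?_ (Real.one_sub_inv_le_log_of_pos hp)
    have : 1 - (1 + 0.13 * (1 - α))⁻¹ = 0.13 * (1 - α) / (1 + 0.13 * (1 - α)) := by
      field_simp
      ring
    rw [this, le_div_iff₀ hp]
    nlinarith [mul_nonneg (sub_nonneg.2 h1) h0.le]
  have hk' := mul_le_mul_of_nonneg_left hk (sub_nonneg.2 h1)
  have hl' := mul_le_mul_of_nonneg_left hl h0.le
  suffices h : (1 + α) * Real.log α ≤ (1 - α) * (-2.041) + α * (0.115 * (1 - α)) by linarith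
  rcases le_total α 0.36 with h | h
  · have ht : Real.log α ≤ 4 * α - 2.386 := by
      have e : Real.log α = Real.log (4 * α) - 2 * Real.log 2 := by
        rw [show (4 : ℝ) * α = 2 ^ 2 * α by ring, Real.log_mul (by norm_num) h0.ne', Real.log_pow]
        push_cast
        ring
      have := Real.log_le_sub_one_of_pos (show 0 < 4 * α by linarith)
      have := Real.log_two_gt_d9
      linarith
    have := mul_le_mul_of_nonneg_left ht (show 0 ≤ 1 + α by linarith)
    nlinarith [mul_nonneg h0.le (sub_nonneg.2 h)]
  · have ht : 2 * (1 - α) ≤ (1 + α) * (- Real.log α) := by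
      have hx : 0 ≤ 1 / α - 1 := by
        rw [sub_nonneg, le_div_iff₀ h0]
        linarith
      have := Real.le_log_one_add_of_nonneg hx
      rw [add_sub_cancel, one_div, Real.log_inv, inv_eq_one_div,
        show 2 * (1 / α - 1) / (1 / α - 1 + 2) = 2 * (1 - α) / (1 + α) by
          rw [div_eq_div_iff (by linarith) (by linarith)]
          field_simp
          ring,
        div_le_iff₀ (by linarith)] at this
      linarith
    nlinarith [mul_nonneg (sub_nonneg.2 h1) (sub_nonneg.2 h)]

lemma hs_key (α s : ℝ) (h0 : 0 < α) (h1 : α ≤ 1) (hs : 0 ≤ s) :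
    (1 + s ^ α) ^ α ≤ (1 + 0.13 * (1 - α)) * (1 + s) := by
  have hsa : 0 ≤ s ^ α := Real.rpow_nonneg hs _
  have hb := rpow_one_add_le_one_add_mul_self (by linarith : -1 ≤ s ^ α) h0.le h1
  have hp : 0 < 1 + 0.13 * (1 - α) := by linarith
  have hq : 0 < (1 + 0.13 * (1 - α)) / α := by positivity
  have hg := Real.geom_mean_le_arith_mean2_weighted (w₁ := 1 - α) (w₂ := α) (p₁ := 0.13)
    (p₂ := (1 + 0.13 * (1 - α)) / α * s) (by linarith) h0.le (by norm_num) (by positivity) (by ring)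
  have hc : α ≤ (0.13 : ℝ) ^ (1 - α) * ((1 + 0.13 * (1 - α)) / α) ^ α := by
    have := hs_log α h0 h1
    rw [← Real.log_le_log_iff h0 (by positivity), Real.log_mul (by positivity) (by positivity),
      Real.log_rpow (by norm_num), Real.log_rpow hq, Real.log_div hp.ne' h0.ne']
    exact this
  rw [Real.mul_rpow hq.le hs, ← mul_assoc,
    show α * ((1 + 0.13 * (1 - α)) / α * s) = (1 + 0.13 * (1 - α)) * s by field_simp] at hg
  have := mul_le_mul_of_nonneg_right hc hsa
  linarith

lemma hs_scale (α A u a : ℝ) (h0 : 0 < α) (hA : 1 ≤ A) (ha : 0 ≤ a) (h : a ≤ A * u) :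
    (1 + a ^ 2) ^ α ≤ A ^ (2 * α) * (1 + u ^ 2) ^ α := by
  have hA0 : 0 ≤ A := by linarith
  rw [Real.rpow_mul hA0, ← Real.mul_rpow (by positivity) (by positivity)]
  apply Real.rpow_le_rpow (by positivity) _ h0.le
  rw [Real.rpow_two]
  have := pow_le_pow_left₀ ha h 2
  nlinarith

lemma hs_point (α β A B a t : ℝ) (h0 : 0 < α) (h1 : α ≤ 1) (hβ : β = 1 / α)
    (hA : 1 ≤ A) (hB : 1 ≤ B) (ha : 0 ≤ a) (ht : 0 ≤ t)
    (hA' : 1 ≤ t → a ≤ A * t ^ β) (hB' : t ≤ 1 → a ≤ B * t ^ α) :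
    (1 + a ^ 2) ^ α ≤ max (A ^ (2 * α)) (B ^ (2 * α) * (1 + 0.13 * (1 - α))) * (1 + t ^ 2) := by
  rcases le_total 1 t with h | h
  · refine le_trans (hs_scale α A _ a h0 hA ha (hA' h)) ?_
    refine mul_le_mul (le_max_left _ _) ?_ (by positivity) (le_trans (by positivity) (le_max_left _ _))
    refine le_trans (Real.rpow_add_le_add_rpow (by norm_num) (by positivity) h0.le h1) ?_
    rw [Real.one_rpow, ← Real.rpow_natCast, ← Real.rpow_mul ht, ← Real.rpow_mul ht, hβ,
      show 1 / α * ((2 : ℕ) : ℝ) * α = ((2 : ℕ) : ℝ) by field_simp, Real.rpow_natCast]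
  · refine le_trans (hs_scale α B _ a h0 hB ha (hB' h)) ?_
    have hk := hs_key α (t ^ 2) h0 h1 (by positivity)
    have e : (t ^ α) ^ 2 = (t ^ 2) ^ α := by
      rw [← Real.rpow_natCast, ← Real.rpow_natCast, ← Real.rpow_mul ht, ← Real.rpow_mul ht, mul_comm]
    rw [e]
    refine le_trans (mul_le_mul_of_nonneg_left hk (by positivity)) ?_
    rw [← mul_assoc]
    exact mul_le_mul_of_nonneg_right (le_max_right _ _) (by positivity)

theorem holder_spherical_qc {n : ℕ} (hn : 2 ≤ n) (α β M A B R : ℝ)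
    (hα0 : 0 < α) (hα1 : α ≤ 1) (hβ : β = 1 / α)
    (hM : 1 ≤ M) (hA : 1 ≤ A) (hB : 1 ≤ B) (hR : 1 ≤ R)
    (f : EuclideanSpace ℝ (Fin n) → EuclideanSpace ℝ (Fin n)) (hf0 : f 0 = 0)
    (hHolder : ∀ x y, ‖x‖ ≤ R → ‖y‖ ≤ R → ‖f x - f y‖ ≤ M * ‖x - y‖ ^ α)
    (hA' : ∀ x, ‖x‖ ≤ R → 1 ≤ ‖f x‖ → ‖x‖ ≤ A * ‖f x‖ ^ β)
    (hB' : ∀ x, ‖x‖ ≤ R → ‖f x‖ ≤ 1 → ‖x‖ ≤ B * ‖f x‖ ^ α) :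
    ∀ x y, ‖x‖ ≤ R → ‖y‖ ≤ R →
      sphericalDist (f x) (f y) ≤
        M * max (A ^ (2 * α)) (B ^ (2 * α) * (1 + 0.13 * (1 - α))) *
          sphericalDist x y ^ α := by
  intro x y hx hy
  have px := hs_point α β A B ‖x‖ ‖f x‖ hα0 hα1 hβ hA hB (norm_nonneg _) (norm_nonneg _)
    (hA' x hx) (hB' x hx)
  have py := hs_point α β A B ‖y‖ ‖f y‖ hα0 hα1 hβ hA hB (norm_nonneg _) (norm_nonneg _)
    (hA' y hy) (hB' y hy)
  set C := max (A ^ (2 * α)) (B ^ (2 * α) * (1 + 0.13 * (1 - α))) with hC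
  have hC0 : 0 ≤ C := le_trans (by positivity) (le_max_left _ _)
  have hH := hHolder x y hx hy
  unfold sphericalDist
  rw [← Real.sqrt_mul (by positivity), ← Real.sqrt_mul (by positivity),
    Real.div_rpow (norm_nonneg _) (Real.sqrt_nonneg _), div_le_iff₀ (by positivity)]
  have hD : 0 < √((1 + ‖x‖ ^ 2) * (1 + ‖y‖ ^ 2)) ^ α := by positivity
  have hS : √((1 + ‖x‖ ^ 2) * (1 + ‖y‖ ^ 2)) ^ α ≤ C * √((1 + ‖f x‖ ^ 2) * (1 + ‖f y‖ ^ 2)) := by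
    have e : √((1 + ‖x‖ ^ 2) * (1 + ‖y‖ ^ 2)) ^ α
        = √((1 + ‖x‖ ^ 2) ^ α * (1 + ‖y‖ ^ 2) ^ α) := by
      rw [← Real.mul_rpow (by positivity) (by positivity), Real.sqrt_eq_rpow, Real.sqrt_eq_rpow,
        ← Real.rpow_mul (by positivity), ← Real.rpow_mul (by positivity), mul_comm α]
    rw [e]
    refine Real.sqrt_le_iff.2 ⟨by positivity, ?_⟩
    rw [mul_pow, Real.sq_sqrt (by positivity)]
    refine le_trans (mul_le_mul px py (by positivity) (by positivity)) (le_of_eq (by ring))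
  refine le_trans hH ?_
  rw [show M * C * (‖x - y‖ ^ α / √((1 + ‖x‖ ^ 2) * (1 + ‖y‖ ^ 2)) ^ α) *
      √((1 + ‖f x‖ ^ 2) * (1 + ‖f y‖ ^ 2)) = (M * ‖x - y‖ ^ α) *
      (C * √((1 + ‖f x‖ ^ 2) * (1 + ‖f y‖ ^ 2))) / √((1 + ‖x‖ ^ 2) * (1 + ‖y‖ ^ 2)) ^ α by ring,
    le_div_iff₀ hD]
  exact mul_le_mul_of_nonneg_left hS (by positivity)
end
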